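/- arXiv:1612.05504 — 5 statements merged into one kernel-verified Lean document; each statement's English description precedes it below -/
import Mathlib

section
/- Let Φ, Φ' ∈ ℂ⁴ satisfy Φ² = 0, Φ·Φ' = 0 and ‖Φ‖² > 0, and define Φ'⊥ := Φ' − ((Φ'·Φ̄)/‖Φ‖²)·Φ. Then (Φ'⊥)² = 0 if and only if both ‖Φ‖²·‖Φ'‖² − |Φ'·Φ̄|² = 0 and det(Φ, Φ̄, Φ', Φ̄') = 0. (Geometrically: a point of a minimal space-like surface is degenerate if and only if the Gauss curvature K and the normal curvature κ both vanish there.) -/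
/-- The complex-bilinear Minkowski product on `ℂ⁴`. -/
noncomputable def mdot (a b : Fin 4 → ℂ) : ℂ :=
  a 0 * b 0 + a 1 * b 1 + a 2 * b 2 - a 3 * b 3

/-- Componentwise complex conjugation on `ℂ⁴`. -/
noncomputable def mconj (a : Fin 4 → ℂ) : Fin 4 → ℂ :=
  fun i => (starRingEnd ℂ) (a i)

/-- The indefinite Hermitian square `‖a‖² = a·ā` (a real number). -/
noncomputable def hnormSq (a : Fin 4 → ℂ) : ℝ :=
  (mdot a (mconj a)).re

/-- The determinant of the `4×4` complex matrix with columns `a, b, c, d ∈ ℂ⁴`. -/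
noncomputable def detC (a b c d : Fin 4 → ℂ) : ℂ :=
  Matrix.det (Matrix.transpose (Matrix.of ![a, b, c, d]))

theorem mdot_comm (a b : Fin 4 → ℂ) : mdot a b = mdot b a := by
  unfold mdot
  ring

theorem mconj_mconj (a : Fin 4 → ℂ) : mconj (mconj a) = a := by
  funext i
  simp [mconj]

theorem mdot_mconj_mconj (a b : Fin 4 → ℂ) :
    mdot (mconj a) (mconj b) = (starRingEnd ℂ) (mdot a b) := by
  simp [mdot, mconj]

theorem ofReal_hnormSq (a : Fin 4 → ℂ) : (hnormSq a : ℂ) = mdot a (mconj a) := by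
  refine Complex.conj_eq_iff_re.mp ?_
  rw [← mdot_mconj_mconj, mconj_mconj, mdot_comm]

theorem detC_eq (a b c d : Fin 4 → ℂ) :
    detC a b c d = Matrix.det (Matrix.of ![a, b, c, d]) :=
  Matrix.det_transpose _

/-- The Gram determinant of four vectors for the Minkowski product is minus the square of
their determinant. -/
theorem det_gram_eq_neg_detC_sq (a b c d : Fin 4 → ℂ) :
    Matrix.det !![mdot a a, mdot a b, mdot a c, mdot a d;
                  mdot b a, mdot b b, mdot b c, mdot b d;
                  mdot c a, mdot c b, mdot c c, mdot c d;
                  mdot d a, mdot d b, mdot d c, mdot d d] = -(detC a b c d) ^ 2 := by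
  have hG : !![mdot a a, mdot a b, mdot a c, mdot a d;
               mdot b a, mdot b b, mdot b c, mdot b d;
               mdot c a, mdot c b, mdot c c, mdot c d;
               mdot d a, mdot d b, mdot d c, mdot d d] =
      Matrix.of ![a, b, c, d] * Matrix.diagonal ![1, 1, 1, -1] *
        (Matrix.of ![a, b, c, d]).transpose := by
    ext i j
    fin_cases i <;> fin_cases j <;>
      simp [Matrix.mul_apply, Fin.sum_univ_four, mdot, Matrix.vecMul_diagonal] <;> ring
  rw [hG, Matrix.det_mul, Matrix.det_mul, Matrix.det_transpose, Matrix.det_diagonal, detC_eq]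
  simp [Fin.prod_univ_four]
  ring

/-- The determinant of two vectors and their conjugates is real. -/
theorem conj_detC_mconj (a b : Fin 4 → ℂ) :
    (starRingEnd ℂ) (detC a (mconj a) b (mconj b)) = detC a (mconj a) b (mconj b) := by
  simp [detC_eq, Matrix.det_succ_row_zero, Fin.sum_univ_succ, Fin.succAbove, mconj]
  ring

/-- For null `a` orthogonal to `b`, the Gram determinant of `a, ā, b, b̄` expresses
`‖a‖⁴ |b²|²` as a sum of two real squares. -/
theorem hnormSq_sq_mul_normSq_mdot_self (a b : Fin 4 → ℂ) (haa : mdot a a = 0)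
    (hab : mdot a b = 0) :
    hnormSq a ^ 2 * Complex.normSq (mdot b b) =
      (hnormSq a * hnormSq b - Complex.normSq (mdot b (mconj a))) ^ 2 +
        (detC a (mconj a) b (mconj b)).re ^ 2 := by
  have hD := Complex.conj_eq_iff_re.mp (conj_detC_mconj a b)
  have hg := det_gram_eq_neg_detC_sq a (mconj a) b (mconj b)
  have e : mdot a (mconj b) = (starRingEnd ℂ) (mdot b (mconj a)) := by
    rw [← mdot_mconj_mconj, mconj_mconj, mdot_comm]
  rw [mdot_comm (mconj a) a, mdot_comm (mconj a) b, mdot_comm b a,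
    mdot_comm (mconj b) a, mdot_comm (mconj b) (mconj a), mdot_comm (mconj b) b,
    mdot_mconj_mconj, mdot_mconj_mconj, mdot_mconj_mconj, e, haa, hab,
    ← ofReal_hnormSq, ← ofReal_hnormSq, ← hD] at hg
  simp [Matrix.det_succ_row_zero, Fin.sum_univ_succ, Fin.succAbove] at hg
  apply Complex.ofReal_injective
  push_cast
  rw [← Complex.mul_conj, ← Complex.mul_conj]
  linear_combination -hg

/-- Subtracting a multiple of a null vector orthogonal to `b` does not change `b²`. -/
theorem mdot_self_sub_smul (a b : Fin 4 → ℂ) (t : ℂ) (haa : mdot a a = 0)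
    (hab : mdot a b = 0) :
    mdot (fun i => b i - t * a i) (fun i => b i - t * a i) = mdot b b := by
  unfold mdot at *
  linear_combination t ^ 2 * haa - 2 * t * hab

/-- If `Φ² = 0`, `Φ·Φ' = 0` and `‖Φ‖² > 0`, then the normal projection
`Φ'⊥ = Φ' - ((Φ'·Φ̄)/‖Φ‖²)·Φ` satisfies `(Φ'⊥)² = 0` if and only if both
`‖Φ‖²·‖Φ'‖² - |Φ'·Φ̄|² = 0` and `det(Φ, Φ̄, Φ', Φ̄') = 0` (a point of a minimal
space-like surface is degenerate iff the Gauss curvature and normal curvature both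
vanish there). -/
theorem degenerate_iff_K_kappa_zero (Φ Φ' : Fin 4 → ℂ)
    (h1 : mdot Φ Φ = 0) (h2 : mdot Φ Φ' = 0) (h3 : 0 < hnormSq Φ)
    (Φperp : Fin 4 → ℂ)
    (hperp : Φperp = fun i => Φ' i - (mdot Φ' (mconj Φ) / (hnormSq Φ : ℂ)) * Φ i) :
    mdot Φperp Φperp = 0 ↔
      (hnormSq Φ * hnormSq Φ' - Complex.normSq (mdot Φ' (mconj Φ)) = 0 ∧
       detC Φ (mconj Φ) Φ' (mconj Φ') = 0) := by
  rw [hperp, mdot_self_sub_smul Φ Φ' _ h1 h2]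
  have key := hnormSq_sq_mul_normSq_mdot_self Φ Φ' h1 h2
  have hD := Complex.conj_eq_iff_re.mp (conj_detC_mconj Φ Φ')
  rw [← hD, Complex.ofReal_eq_zero, ← Complex.normSq_eq_zero]
  constructor
  · intro h
    rw [h, mul_zero] at key
    constructor <;> nlinarith
  · rintro ⟨hK, hκ⟩
    rw [hK, hκ] at key
    simpa [h3.ne'] using key
end

section
/- Let D ⊆ ℂ be open, Φ : D → ℂ⁴ holomorphic with Φ² ≡ 0 on D, and let t₀ ∈ D with (Φ'(t₀))² ≠ 0. Then there exist open sets V ⊆ ℂ and U ⊆ D with t₀ ∈ U, a point s₀ ∈ V, and an injective holomorphic map t : V → U with t(s₀) = t₀ and t'(s) ≠ 0 for all s ∈ V, such that (Φ'(t(s)))²·(t'(s))⁴ = 1 for all s ∈ V (canonical coordinates of the first type); likewise there exists such a map with (Φ'(t(s)))²·(t'(s))⁴ = −1 (canonical coordinates of the second type). -/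
/-- The componentwise complex derivative of a map `ℂ → ℂ⁴`. -/
noncomputable def derivC (Φ : ℂ → Fin 4 → ℂ) (t : ℂ) : Fin 4 → ℂ :=
  fun i => deriv (fun s => Φ s i) t

/-- A nonvanishing holomorphic germ has a holomorphic `n`-th root on a small ball. -/
theorem exists_ball_nthRoot {D : Set ℂ} (hD : IsOpen D) {f : ℂ → ℂ}
    (hf : DifferentiableOn ℂ f D) {t₀ : ℂ} (ht₀ : t₀ ∈ D) (hne : f t₀ ≠ 0)
    {n : ℕ} (hn : n ≠ 0) :
    ∃ r > 0, Metric.ball t₀ r ⊆ D ∧ ∃ g : ℂ → ℂ,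
      DifferentiableOn ℂ g (Metric.ball t₀ r) ∧
      ∀ z ∈ Metric.ball t₀ r, g z ≠ 0 ∧ g z ^ n = f z := by
  obtain ⟨c, hc⟩ := IsAlgClosed.exists_pow_nat_eq (f t₀) (Nat.pos_of_ne_zero hn)
  have hcont : ContinuousAt (fun z => f z / f t₀) t₀ :=
    (hf.continuousOn.continuousAt (hD.mem_nhds ht₀)).div_const _
  have hslit : ∀ᶠ z in nhds t₀, f z / f t₀ ∈ Complex.slitPlane :=
    hcont.eventually (Complex.isOpen_slitPlane.mem_nhds (by simp [div_self hne]))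
  obtain ⟨r, hr, hball⟩ := Metric.eventually_nhds_iff_ball.1
    ((hD.eventually_mem ht₀).and hslit)
  refine ⟨r, hr, fun z hz => (hball z hz).1,
    fun z => c * (f z / f t₀) ^ ((n : ℂ)⁻¹), ?_, fun z hz => ?_⟩
  · exact (((hf.mono fun z hz => (hball z hz).1).div_const _).cpow_const
      fun z hz => (hball z hz).2).const_mul _
  · have hpow : (c * (f z / f t₀) ^ ((n : ℂ)⁻¹)) ^ n = f z := by
      rw [mul_pow, hc, Complex.cpow_nat_inv_pow _ hn, mul_div_cancel₀ _ hne]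
    refine ⟨fun h0 => ?_, hpow⟩
    have hfz : f z = 0 := by rw [← hpow]; exact (congrArg (· ^ n) h0).trans (zero_pow hn)
    exact Complex.slitPlane_ne_zero (hball z hz).2 (by rw [hfz, zero_div])

/-- Near a point where the holomorphic function `f` does not vanish, the differential equation
`f (t s) * t'(s) ^ n = ε` has an injective holomorphic solution `t` through that point. -/
theorem exists_injOn_mul_deriv_pow_eq {D : Set ℂ} (hD : IsOpen D) {f : ℂ → ℂ}
    (hf : DifferentiableOn ℂ f D) {t₀ : ℂ} (ht₀ : t₀ ∈ D) (hne : f t₀ ≠ 0)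
    {n : ℕ} (hn : n ≠ 0) {ε : ℂ} (hε : ε ≠ 0) :
    ∃ (V U : Set ℂ) (s₀ : ℂ) (t : ℂ → ℂ),
      IsOpen V ∧ IsOpen U ∧ U ⊆ D ∧ t₀ ∈ U ∧ s₀ ∈ V ∧
      Set.InjOn t V ∧ (∀ s ∈ V, t s ∈ U) ∧ DifferentiableOn ℂ t V ∧
      t s₀ = t₀ ∧ (∀ s ∈ V, deriv t s ≠ 0) ∧
      (∀ s ∈ V, f (t s) * (deriv t s) ^ n = ε) := by
  obtain ⟨r, hr, hrD, g, hg, hgn⟩ := exists_ball_nthRoot hD (hf.div_const ε) ht₀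
    (div_ne_zero hne hε) hn
  obtain ⟨F, hF⟩ := hg.isExactOn_ball
  have hmem := Metric.mem_ball_self (x := t₀) hr
  have hFd : DifferentiableOn ℂ F (Metric.ball t₀ r) :=
    fun z hz => (hF z hz).differentiableAt.differentiableWithinAt
  have hstrict : HasStrictDerivAt F (g t₀) t₀ := by
    have h := (hFd.analyticAt (Metric.isOpen_ball.mem_nhds hmem)).hasStrictDerivAt
    rwa [(hF t₀ hmem).deriv] at h
  have hequiv := hstrict.hasStrictFDerivAt_equiv (hgn t₀ hmem).1
  let e := (hequiv.toOpenPartialHomeomorph F).restrOpen (Metric.ball t₀ r) Metric.isOpen_ball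
  have hsource : ∀ z ∈ e.source, z ∈ Metric.ball t₀ r := fun z hz => hz.2
  have hmem_e : t₀ ∈ e.source := ⟨hequiv.mem_toOpenPartialHomeomorph_source, hmem⟩
  have hder : ∀ s ∈ e.target, HasDerivAt e.symm (g (e.symm s))⁻¹ s := fun s hs =>
    have hs' := hsource _ (e.map_target hs)
    e.hasDerivAt_symm hs (hgn _ hs').1 (hF _ hs')
  refine ⟨e.target, e.source, e t₀, e.symm, e.open_target, e.open_source,
    fun z hz => hrD (hsource z hz), hmem_e, e.map_source hmem_e, e.symm.injOn,
    fun s hs => e.map_target hs,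
    fun s hs => (hder s hs).differentiableAt.differentiableWithinAt, e.left_inv hmem_e,
    fun s hs => ?_, fun s hs => ?_⟩
  · rw [(hder s hs).deriv]
    exact inv_ne_zero (hgn _ (hsource _ (e.map_target hs))).1
  · obtain ⟨h0, hp⟩ := hgn _ (hsource _ (e.map_target hs))
    rw [(hder s hs).deriv, inv_pow, ← div_eq_mul_inv, div_eq_iff (pow_ne_zero n h0), hp,
      mul_div_cancel₀ _ hε]

theorem differentiableOn_mdot_derivC {D : Set ℂ} (hD : IsOpen D) {Φ : ℂ → Fin 4 → ℂ}
    (hΦ : ∀ i : Fin 4, DifferentiableOn ℂ (fun t => Φ t i) D) :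
    DifferentiableOn ℂ (fun t => mdot (derivC Φ t) (derivC Φ t)) D := by
  have h : ∀ i, DifferentiableOn ℂ (fun t => derivC Φ t i) D := fun i => (hΦ i).deriv hD
  exact ((((h 0).mul (h 0)).add ((h 1).mul (h 1))).add ((h 2).mul (h 2))).sub
    ((h 3).mul (h 3))

/-- Existence of canonical coordinates. If `Φ : D → ℂ⁴` is holomorphic on an
open `D` with `Φ² ≡ 0`, and `(Φ'(t₀))² ≠ 0` at some `t₀ ∈ D`, then for `ε = 1` (first
type) and likewise for `ε = -1` (second type) there exist open sets `V` and `U ⊆ D` with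
`t₀ ∈ U`, a point `s₀ ∈ V` and an injective holomorphic map `t : V → U` with
`t(s₀) = t₀`, `t' ≠ 0` on `V`, such that `(Φ'(t(s)))²·(t'(s))⁴ = ε` for all `s ∈ V`. -/
theorem canonical_coordinates_exist (D : Set ℂ) (hD : IsOpen D) (Φ : ℂ → Fin 4 → ℂ)
    (hΦ : ∀ i : Fin 4, DifferentiableOn ℂ (fun t => Φ t i) D)
    (hΦ2 : ∀ t ∈ D, mdot (Φ t) (Φ t) = 0)
    (t₀ : ℂ) (ht₀ : t₀ ∈ D)
    (hnd : mdot (derivC Φ t₀) (derivC Φ t₀) ≠ 0) :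
    ∀ ε : ℂ, (ε = 1 ∨ ε = -1) →
      ∃ (V U : Set ℂ) (s₀ : ℂ) (t : ℂ → ℂ),
        IsOpen V ∧ IsOpen U ∧ U ⊆ D ∧ t₀ ∈ U ∧ s₀ ∈ V ∧
        Set.InjOn t V ∧ (∀ s ∈ V, t s ∈ U) ∧ DifferentiableOn ℂ t V ∧
        t s₀ = t₀ ∧ (∀ s ∈ V, deriv t s ≠ 0) ∧
        (∀ s ∈ V, mdot (derivC Φ (t s)) (derivC Φ (t s)) * (deriv t s) ^ 4 = ε) := by
  intro ε hε
  have hε0 : ε ≠ 0 := by rcases hε with rfl | rfl <;> simp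
  exact exists_injOn_mul_deriv_pow_eq hD (differentiableOn_mdot_derivC hD hΦ) ht₀ hnd
    four_ne_zero hε0
end

section
/- Let D, V ⊆ ℂ be open and connected, Φ : D → ℂ⁴ holomorphic with Φ² ≡ 0 and (Φ')² ≡ 1 on D, and let t : V → D be holomorphic with (Φ'(t(s)))²·(t'(s))⁴ = 1 for all s ∈ V. Then (t')⁴ ≡ 1 on V, hence there exist ε ∈ {1, −1, i, −i} and c ∈ ℂ such that t(s) = ε·s + c for all s ∈ V. (Canonical coordinates of a given type are unique up to such substitutions.) -/
theorem Complex.pow_four_eq_one_iff (z : ℂ) :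
    z ^ 4 = 1 ↔ z = 1 ∨ z = -1 ∨ z = Complex.I ∨ z = -Complex.I := by
  constructor
  · intro h
    have hfac : (z - 1) * ((z + 1) * ((z - Complex.I) * (z + Complex.I))) = 0 := by
      linear_combination h - (z ^ 2 - 1) * Complex.I_sq
    simpa [sub_eq_zero, add_eq_zero_iff_eq_neg] using hfac
  · rintro (rfl | rfl | rfl | rfl) <;> simp [Even.neg_pow (by decide : Even 4)]

/-- A holomorphic function on a connected open set whose derivative takes values in a
finite set is affine there. -/
theorem IsOpen.exists_eq_mul_add_of_deriv_mem_finite {V T : Set ℂ} (hV : IsOpen V)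
    (hVc : IsConnected V) (hT : T.Finite) {f : ℂ → ℂ} (hf : DifferentiableOn ℂ f V)
    (hfT : Set.MapsTo (deriv f) V T) : ∃ a ∈ T, ∃ c : ℂ, ∀ s ∈ V, f s = a * s + c := by
  have hne : T.Nonempty := hVc.nonempty.imp' (deriv f) fun _ hs => hfT hs
  obtain ⟨a, ha, hfa⟩ := hVc.isPreconnected.eqOn_const_of_mapsTo hT.isDiscrete
    (hf.deriv hV).continuousOn hfT hne
  have hderiv : ∀ s ∈ V, HasDerivAt (fun s => f s - a * s) 0 s := fun s hs => by
    have h := (hf.differentiableAt (hV.mem_nhds hs)).hasDerivAt.fun_sub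
      ((hasDerivAt_id s).const_mul a)
    have hs' : deriv f s = a := hfa hs
    simpa [hs'] using h
  obtain ⟨c, hc⟩ := hV.exists_is_const_of_deriv_eq_zero hVc.isPreconnected
    (fun s hs => (hderiv s hs).differentiableAt.differentiableWithinAt)
    (fun s hs => (hderiv s hs).deriv)
  exact ⟨a, ha, c, fun s hs => by linear_combination hc s hs⟩

/-- Uniqueness of canonical coordinates. If `Φ : D → ℂ⁴` is holomorphic on
the open connected set `D` with `Φ² ≡ 0` and `(Φ')² ≡ 1`, and `t : V → D` is holomorphic
on the open connected set `V` with `(Φ'(t(s)))²·(t'(s))⁴ = 1` on `V`, then `(t')⁴ ≡ 1`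
on `V`; hence `t(s) = ε·s + c` for some `ε ∈ {1, -1, i, -i}` and `c ∈ ℂ`. -/
theorem canonical_coordinates_unique (D V : Set ℂ)
    (hD : IsOpen D) (hDc : IsConnected D) (hV : IsOpen V) (hVc : IsConnected V)
    (Φ : ℂ → Fin 4 → ℂ)
    (hΦ : ∀ i : Fin 4, DifferentiableOn ℂ (fun t => Φ t i) D)
    (hΦ2 : ∀ t ∈ D, mdot (Φ t) (Φ t) = 0)
    (hΦ'2 : ∀ t ∈ D, mdot (derivC Φ t) (derivC Φ t) = 1)
    (t : ℂ → ℂ) (ht : DifferentiableOn ℂ t V) (htD : ∀ s ∈ V, t s ∈ D)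
    (hcan : ∀ s ∈ V, mdot (derivC Φ (t s)) (derivC Φ (t s)) * (deriv t s) ^ 4 = 1) :
    (∀ s ∈ V, (deriv t s) ^ 4 = 1) ∧
    ∃ ε c : ℂ, (ε = 1 ∨ ε = -1 ∨ ε = Complex.I ∨ ε = -Complex.I) ∧
      ∀ s ∈ V, t s = ε * s + c := by
  have hpow : ∀ s ∈ V, (deriv t s) ^ 4 = 1 := fun s hs => by
    simpa [hΦ'2 (t s) (htD s hs)] using hcan s hs
  refine ⟨hpow, ?_⟩
  obtain ⟨ε, hε, c, hc⟩ := hV.exists_eq_mul_add_of_deriv_mem_finite hVc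
    (Set.toFinite {1, -1, Complex.I, -Complex.I}) ht
    fun s hs => (Complex.pow_four_eq_one_iff _).1 (hpow s hs)
  exact ⟨ε, c, hε, hc⟩
end

section
/- Let D ⊆ ℂ be open, f, g₁, g₂ : D → ℂ holomorphic, and define Φ : D → ℂ⁴ by Φ = (i·f·(g₁g₂+1), f·(g₁g₂−1), f·(g₁+g₂), f·(g₁−g₂)). Then the Minkowski bilinear square of the derivative satisfies (Φ')² = 4·f²·g₁'·g₂' on D. In particular, the parameters are canonical of the first type ((Φ')² = 1) if and only if 4·f²·g₁'·g₂' = 1. -/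
/-- For holomorphic `f, g₁, g₂` on an open `D ⊆ ℂ` and the polynomial
Weierstrass data `Φ = (i f (g₁g₂+1), f (g₁g₂-1), f (g₁+g₂), f (g₁-g₂))`, one has
`(Φ')² = 4 f² g₁' g₂'` on `D`; in particular the parameters are canonical of the
first type (`(Φ')² = 1`) iff `4 f² g₁' g₂' = 1`. -/
theorem polynomial_Weierstrass_deriv_sq (D : Set ℂ) (hD : IsOpen D) (f g₁ g₂ : ℂ → ℂ)
    (hf : DifferentiableOn ℂ f D)
    (hg₁ : DifferentiableOn ℂ g₁ D) (hg₂ : DifferentiableOn ℂ g₂ D)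
    (Φ : ℂ → Fin 4 → ℂ)
    (hΦ : ∀ t : ℂ, Φ t = ![Complex.I * f t * (g₁ t * g₂ t + 1),
                           f t * (g₁ t * g₂ t - 1),
                           f t * (g₁ t + g₂ t),
                           f t * (g₁ t - g₂ t)]) :
    ∀ t ∈ D,
      mdot (derivC Φ t) (derivC Φ t) = 4 * f t ^ 2 * deriv g₁ t * deriv g₂ t ∧
      (mdot (derivC Φ t) (derivC Φ t) = 1 ↔ 4 * f t ^ 2 * deriv g₁ t * deriv g₂ t = 1) := by
  intro t ht
  have hDt := hD.mem_nhds ht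
  have hf' := (hf.differentiableAt hDt).hasDerivAt
  have hg₁' := (hg₁.differentiableAt hDt).hasDerivAt
  have hg₂' := (hg₂.differentiableAt hDt).hasDerivAt
  have h0 : derivC Φ t 0 = Complex.I * deriv f t * (g₁ t * g₂ t + 1) + Complex.I * f t *
      (deriv g₁ t * g₂ t + g₁ t * deriv g₂ t) := by
    simp only [derivC, hΦ]
    exact ((hf'.const_mul Complex.I).mul ((hg₁'.mul hg₂').add_const 1)).deriv
  have h1 : derivC Φ t 1 = deriv f t * (g₁ t * g₂ t - 1) + f t *
      (deriv g₁ t * g₂ t + g₁ t * deriv g₂ t) := by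
    simp only [derivC, hΦ]
    exact (hf'.mul ((hg₁'.mul hg₂').sub_const 1)).deriv
  have h2 : derivC Φ t 2 = deriv f t * (g₁ t + g₂ t) + f t * (deriv g₁ t + deriv g₂ t) := by
    simp only [derivC, hΦ]
    exact (hf'.mul (hg₁'.add hg₂')).deriv
  have h3 : derivC Φ t 3 = deriv f t * (g₁ t - g₂ t) + f t * (deriv g₁ t - deriv g₂ t) := by
    simp only [derivC, hΦ]
    exact (hf'.mul (hg₁'.sub hg₂')).deriv
  have key : mdot (derivC Φ t) (derivC Φ t) = 4 * f t ^ 2 * deriv g₁ t * deriv g₂ t := by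
    rw [mdot, h0, h1, h2, h3]
    linear_combination (deriv f t * (g₁ t * g₂ t + 1) +
      f t * (deriv g₁ t * g₂ t + g₁ t * deriv g₂ t)) ^ 2 * Complex.I_sq
  exact ⟨key, by rw [key]⟩
end

section
/- Let a, b, c, d, f, g₁, g₂ ∈ ℂ with ad − bc = 1. Set à = [[ā, −b̄], [−c̄, d̄]] and S = [[2f·g₁, −2f], [2f·g₁g₂, −2f·g₂]] (the spinor matrix of the Weierstrass data (f, g₁, g₂)). Then Ã·S·Ã* = [[2f·(a g₁ + b)·(−b̄ g₂ + ā), 2f·(c g₁ + d)·(b̄ g₂ − ā)], [2f·(a g₁ + b)·(d̄ g₂ − c̄), 2f·(c g₁ + d)·(−d̄ g₂ + c̄)]], where Ã* is the conjugate transpose. Consequently, if c g₁ + d ≠ 0 and −b̄ g₂ + ā ≠ 0, then Ã·S·Ã* is the spinor matrix of the data f̂ = f·(c g₁ + d)·(−b̄ g₂ + ā), ĝ₁ = (a g₁ + b)/(c g₁ + d), ĝ₂ = (d̄ g₂ − c̄)/(−b̄ g₂ + ā). -/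
/-- The spinor transformation of the Weierstrass data. For
`Ã = [[ā, -b̄], [-c̄, d̄]]` with `ad - bc = 1` and the spinor matrix
`S = [[2fg₁, -2f], [2fg₁g₂, -2fg₂]]` of the Weierstrass data `(f, g₁, g₂)`, one has
`Ã·S·Ã* = [[2f(ag₁+b)(-b̄g₂+ā), 2f(cg₁+d)(b̄g₂-ā)], [2f(ag₁+b)(d̄g₂-c̄),
2f(cg₁+d)(-d̄g₂+c̄)]]`; consequently, if `cg₁+d ≠ 0` and `-b̄g₂+ā ≠ 0`, then
`Ã·S·Ã*` is the spinor matrix of the data `f̂ = f(cg₁+d)(-b̄g₂+ā)`,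
`ĝ₁ = (ag₁+b)/(cg₁+d)`, `ĝ₂ = (d̄g₂-c̄)/(-b̄g₂+ā)`. -/
theorem spinor_transformation (a b c d f g₁ g₂ : ℂ) (h : a * d - b * c = 1)
    (A S : Matrix (Fin 2) (Fin 2) ℂ)
    (hA : A = !![(starRingEnd ℂ) a, -((starRingEnd ℂ) b);
                 -((starRingEnd ℂ) c), (starRingEnd ℂ) d])
    (hS : S = !![2 * f * g₁, -2 * f; 2 * f * g₁ * g₂, -2 * f * g₂]) :
    A * S * A.conjTranspose =
      !![2 * f * (a * g₁ + b) * (-((starRingEnd ℂ) b) * g₂ + (starRingEnd ℂ) a),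
         2 * f * (c * g₁ + d) * ((starRingEnd ℂ) b * g₂ - (starRingEnd ℂ) a);
         2 * f * (a * g₁ + b) * ((starRingEnd ℂ) d * g₂ - (starRingEnd ℂ) c),
         2 * f * (c * g₁ + d) * (-((starRingEnd ℂ) d) * g₂ + (starRingEnd ℂ) c)] ∧
    (c * g₁ + d ≠ 0 → -((starRingEnd ℂ) b) * g₂ + (starRingEnd ℂ) a ≠ 0 →
      ∀ fh g₁h g₂h : ℂ,
        fh = f * (c * g₁ + d) * (-((starRingEnd ℂ) b) * g₂ + (starRingEnd ℂ) a) →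
        g₁h = (a * g₁ + b) / (c * g₁ + d) →
        g₂h = ((starRingEnd ℂ) d * g₂ - (starRingEnd ℂ) c) /
                (-((starRingEnd ℂ) b) * g₂ + (starRingEnd ℂ) a) →
        A * S * A.conjTranspose =
          !![2 * fh * g₁h, -2 * fh; 2 * fh * g₁h * g₂h, -2 * fh * g₂h]) := by
  have key : A * S * A.conjTranspose =
      !![2 * f * (a * g₁ + b) * (-((starRingEnd ℂ) b) * g₂ + (starRingEnd ℂ) a),
         2 * f * (c * g₁ + d) * ((starRingEnd ℂ) b * g₂ - (starRingEnd ℂ) a);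
         2 * f * (a * g₁ + b) * ((starRingEnd ℂ) d * g₂ - (starRingEnd ℂ) c),
         2 * f * (c * g₁ + d) * (-((starRingEnd ℂ) d) * g₂ + (starRingEnd ℂ) c)] := by
    subst hA hS
    ext i j
    fin_cases i <;> fin_cases j <;>
      simp [Matrix.mul_apply, Fin.sum_univ_two, Matrix.conjTranspose_apply] <;> ring
  refine ⟨key, ?_⟩
  rintro h₁ h₂ _ _ _ rfl rfl rfl
  rw [key, show (starRingEnd ℂ) b * g₂ - (starRingEnd ℂ) a =
      -(-((starRingEnd ℂ) b) * g₂ + (starRingEnd ℂ) a) by ring]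
  generalize c * g₁ + d = p at h₁ ⊢
  generalize -((starRingEnd ℂ) b) * g₂ + (starRingEnd ℂ) a = q at h₂ ⊢
  ext i j
  fin_cases i <;> fin_cases j <;> simp <;> field_simp
  ring
end
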